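/- arXiv:1202.1205 — 2 statements merged into one kernel-verified Lean document; each statement's English description precedes it below -/
import Mathlib

section
/- For every positive integer n and every real number x with cos x ≠ 0, differentiating the closed-form expansion of the (2n)-th derivative of tangent term by term gives tan^{(2n+1)}(x) = (1/cos^{2(n+1)} x) · [ (n+1) · a_{2n,1} - a_{2n,2n-1} · cos(2 n x) + Σ_{i=1}^{n-1} ( (n+1+i) · a_{2n,2i+1} - (n+1-i) · a_{2n,2i-1} ) · cos(2 i x) ], where a_{2n,2i+1} = 2 · Σ_{ℓ=0}^{n-i-1} (-1)^{i+ℓ} · C(2n+1, ℓ) · (n-i-ℓ)^{2n} for 0 ≤ i ≤ n-1. -/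
open Finset

/-- The coefficients `a_{2n,2i+1}` in the expansion of the `(2n)`-th derivative of
the tangent function:
`a_{2n,2i+1} = 2 · Σ_{ℓ=0}^{n-i-1} (-1)^{i+ℓ} C(2n+1,ℓ) (n-i-ℓ)^{2n}` for `0 ≤ i ≤ n-1`. -/
noncomputable def aeven (n i : ℕ) : ℝ :=
  2 * ∑ l ∈ Finset.range (n - i),
    (-1 : ℝ) ^ (i + l) * (Nat.choose (2 * n + 1) l : ℝ) * ((n : ℝ) - i - l) ^ (2 * n)

/-- The Eulerian number counting the permutations of `m + 1` letters with `k` descents. -/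
noncomputable def eulerianSucc : ℕ → ℕ → ℝ
  | 0, 0 => 1
  | 0, _ + 1 => 0
  | m + 1, 0 => eulerianSucc m 0
  | m + 1, k + 1 =>
      ((m : ℝ) + 1 - k) * eulerianSucc m k + ((k : ℝ) + 2) * eulerianSucc m (k + 1)

theorem eulerianSucc_eq_zero_of_lt (m : ℕ) : ∀ k, m < k → eulerianSucc m k = 0 := by
  induction m with
  | zero =>
    intro k hk
    obtain ⟨k, rfl⟩ := Nat.exists_eq_succ_of_ne_zero hk.ne'
    rfl
  | succ m ih =>
    intro k hk
    obtain ⟨k, rfl⟩ := Nat.exists_eq_succ_of_ne_zero (Nat.ne_zero_of_lt hk)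
    simp only [eulerianSucc]
    rw [ih k (by omega), ih (k + 1) (by omega)]
    ring

theorem eulerianSucc_symm (m : ℕ) :
    ∀ i j, i + j = m → eulerianSucc m i = eulerianSucc m j := by
  induction m with
  | zero =>
    intro i j h
    obtain ⟨rfl, rfl⟩ : i = 0 ∧ j = 0 := by omega
    rfl
  | succ m ih =>
    have key : eulerianSucc (m + 1) 0 = eulerianSucc (m + 1) (m + 1) := by
      simp only [eulerianSucc]
      rw [eulerianSucc_eq_zero_of_lt m (m + 1) (by omega), ih 0 m (by omega)]
      ring
    intro i j h
    match i, j with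
    | 0, j =>
      obtain rfl : j = m + 1 := by omega
      exact key
    | i, 0 =>
      obtain rfl : i = m + 1 := by omega
      exact key.symm
    | i + 1, j + 1 =>
      simp only [eulerianSucc]
      rw [ih i (j + 1) (by omega), ih (i + 1) j (by omega)]
      have hm : (m : ℝ) = i + j + 1 := by
        have : m = i + j + 1 := by omega
        exact_mod_cast this
      rw [hm]
      ring

theorem eulerianSucc_eq_sum (m : ℕ) : ∀ k, eulerianSucc m k =
    ∑ l ∈ range (k + 1),
      (-1 : ℝ) ^ l * (Nat.choose (m + 2) l : ℝ) * ((k : ℝ) + 1 - l) ^ (m + 1) := by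
  induction m with
  | zero =>
    intro k
    match k with
    | 0 => simp [eulerianSucc]
    | 1 => norm_num [eulerianSucc, sum_range_succ]
    | k + 2 =>
      rw [show eulerianSucc 0 (k + 2) = 0 from rfl, show k + 2 + 1 = 3 + k by ring, sum_range_add,
        sum_eq_zero (s := range k)]
      · norm_num [sum_range_succ]
        ring
      · intro l _
        rw [Nat.choose_eq_zero_of_lt (by omega)]
        simp
  | succ m ih =>
    intro k
    match k with
    | 0 => simp [eulerianSucc, ih]
    | k + 1 =>
      simp only [eulerianSucc]
      rw [ih, ih, sum_range_succ' _ (k + 1), sum_range_succ' _ (k + 1), mul_add, mul_sum, mul_sum,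
        ← add_assoc, ← sum_add_distrib]
      congr 1
      · refine sum_congr rfl fun l hl => ?_
        have h1 : (Nat.choose (m + 1 + 2) (l + 1) : ℝ)
            = Nat.choose (m + 2) l + Nat.choose (m + 2) (l + 1) := by
          exact_mod_cast Nat.choose_succ_succ (m + 2) l
        have h2 : (Nat.choose (m + 2) (l + 1) : ℝ) * (l + 1)
            = Nat.choose (m + 2) l * ((m : ℝ) + 2 - l) := by
          rcases le_or_gt l (m + 2) with h | h
          · have := Nat.choose_succ_right_eq (m + 2) l
            rw [show (m : ℝ) + 2 - l = ((m + 2 - l : ℕ) : ℝ) by push_cast [h]; ring]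
            exact_mod_cast this
          · rw [Nat.choose_eq_zero_of_lt h, Nat.choose_eq_zero_of_lt (by omega : m + 2 < l + 1)]
            simp
        rw [h1]
        push_cast
        rw [show (k : ℝ) + 1 + 1 - (l + 1) = k + 1 - l by ring]
        linear_combination ((-1 : ℝ) ^ l * (k + 1 - l) ^ (m + 1)) * -h2
      · push_cast
        simp
        ring

/-- The numerator of the `(m + 1)`-st derivative of the tangent over `cos x ^ (m + 2)`. -/
noncomputable def tanNumerator (m : ℕ) (x : ℝ) : ℝ :=
  ∑ k ∈ range (m + 1),
    (-1 : ℝ) ^ k * eulerianSucc m k * Real.cos ((2 * k - m) * x + m * (Real.pi / 2))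

theorem tanNumerator_succ (m : ℕ) (x : ℝ) :
    tanNumerator (m + 1) x =
      (∑ k ∈ range (m + 1), (-1 : ℝ) ^ k * eulerianSucc m k *
        (-Real.sin ((2 * k - m) * x + m * (Real.pi / 2)) * (2 * k - m))) * Real.cos x
      + (m + 2) * Real.sin x * tanNumerator m x := by
  obtain ⟨g, hg⟩ : ∃ g : ℕ → ℝ, ∀ k : ℕ,
      g k = Real.sin ((2 * k - m) * x + m * (Real.pi / 2) - x) := ⟨_, fun _ => rfl⟩
  have hcos (k : ℕ) : Real.cos ((2 * k - ((m + 1 : ℕ) : ℝ)) * x + ((m + 1 : ℕ) : ℝ) * (Real.pi / 2))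
      = - g k := by
    rw [hg, ← Real.cos_add_pi_div_two]
    congr 1
    push_cast
    ring
  have hshift : ∑ k ∈ range (m + 1), (-1 : ℝ) ^ k * (k + 1) * eulerianSucc m k * g k
      = ∑ k ∈ range (m + 1), (-1 : ℝ) ^ (k + 1) * (k + 2) * eulerianSucc m (k + 1) * g (k + 1)
        + eulerianSucc m 0 * g 0 := by
    have h := sum_range_succ (fun k : ℕ => (-1 : ℝ) ^ k * (k + 1) * eulerianSucc m k * g k) (m + 1)
    rw [eulerianSucc_eq_zero_of_lt m (m + 1) (by omega), sum_range_succ'] at h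
    simp only [mul_zero, zero_mul, add_zero] at h
    rw [← h]
    congr 1
    · refine sum_congr rfl fun k _ => ?_
      push_cast
      ring
    · simp
  have hL : tanNumerator (m + 1) x =
      ∑ k ∈ range (m + 1), (-1 : ℝ) ^ k * (m + 1 - k) * eulerianSucc m k * g (k + 1)
      - ∑ k ∈ range (m + 1), (-1 : ℝ) ^ k * (k + 1) * eulerianSucc m k * g k := by
    rw [hshift, tanNumerator, sum_range_succ', ← sub_sub, ← sum_sub_distrib,
      sub_eq_add_neg (Finset.sum _ _)]
    congr 1
    · refine sum_congr rfl fun k _ => ?_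
      rw [hcos, eulerianSucc]
      ring
    · rw [hcos, eulerianSucc]
      ring
  rw [hL, tanNumerator, mul_sum, sum_mul, ← sum_add_distrib, ← sum_sub_distrib]
  refine sum_congr rfl fun k _ => ?_
  have h1 : g (k + 1) = Real.sin ((2 * k - m) * x + m * (Real.pi / 2) + x) := by
    rw [hg]
    congr 1
    push_cast
    ring
  rw [h1, hg]
  rw [Real.sin_add _ x, Real.sin_sub _ x]
  ring

theorem hasDerivAt_tanNumerator (m : ℕ) (x : ℝ) :
    HasDerivAt (tanNumerator m)
      (∑ k ∈ range (m + 1), (-1 : ℝ) ^ k * eulerianSucc m k *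
        (-Real.sin ((2 * k - m) * x + m * (Real.pi / 2)) * (2 * k - m))) x := by
  unfold tanNumerator
  refine HasDerivAt.fun_sum fun k _ => ?_
  have h : HasDerivAt (fun y : ℝ => (2 * (k : ℝ) - m) * y + m * (Real.pi / 2))
      (2 * (k : ℝ) - m) x := by
    simpa using ((hasDerivAt_id x).const_mul (2 * (k : ℝ) - m)).add_const ((m : ℝ) * (Real.pi / 2))
  exact h.cos.const_mul _

theorem iteratedDeriv_succ_tan (m : ℕ) : ∀ x : ℝ, Real.cos x ≠ 0 →
    iteratedDeriv (m + 1) Real.tan x = tanNumerator m x / Real.cos x ^ (m + 2) := by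
  induction m with
  | zero =>
    intro x hx
    simp [iteratedDeriv_one, tanNumerator, eulerianSucc, Real.deriv_tan]
  | succ m ih =>
    intro x hx
    have hev : iteratedDeriv (m + 1) Real.tan =ᶠ[nhds x]
        fun y => tanNumerator m y / Real.cos y ^ (m + 2) := by
      filter_upwards [Real.continuous_cos.continuousAt.eventually_ne hx] with y hy using ih y hy
    rw [iteratedDeriv_succ, hev.deriv_eq]
    have hd := (hasDerivAt_tanNumerator m x).div ((Real.hasDerivAt_cos x).pow (m + 2))
      (pow_ne_zero _ hx)
    refine hd.deriv.trans ?_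
    rw [tanNumerator_succ]
    simp only [Pi.pow_apply]
    rw [div_eq_div_iff (by positivity) (by positivity), Nat.add_sub_assoc (by norm_num)]
    push_cast
    ring

theorem sum_range_two_mul_add_one_of_symm (n : ℕ) (G : ℕ → ℝ)
    (hG : ∀ i j, i + j = 2 * n → G i = G j) :
    ∑ k ∈ range (2 * n + 1), G k = G n + 2 * ∑ i ∈ range n, G (n - (i + 1)) := by
  rw [show 2 * n + 1 = n + 1 + n by ring, sum_range_add, sum_range_succ, ← sum_range_reflect G n]
  have h1 : ∑ i ∈ range n, G (n + 1 + i) = ∑ i ∈ range n, G (n - (i + 1)) := by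
    refine sum_congr rfl fun i hi => hG _ _ ?_
    have := mem_range.1 hi
    omega
  have h2 : ∑ i ∈ range n, G (n - 1 - i) = ∑ i ∈ range n, G (n - (i + 1)) := by
    refine sum_congr rfl fun i _ => ?_
    rw [Nat.sub_sub, add_comm]
  rw [h1, h2]
  ring

theorem aeven_eq_eulerianSucc (p i k : ℕ) (h : i + k = p) :
    aeven (p + 1) i = 2 * (-1) ^ i * eulerianSucc (2 * p + 1) k := by
  subst h
  rw [aeven, eulerianSucc_eq_sum, show i + k + 1 - i = k + 1 by omega, mul_assoc,
    mul_sum _ _ ((-1 : ℝ) ^ i)]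
  congr 1
  refine sum_congr rfl fun l _ => ?_
  rw [show 2 * (i + k + 1) + 1 = 2 * (i + k) + 1 + 2 by ring,
    show 2 * (i + k + 1) = 2 * (i + k) + 1 + 1 by ring]
  push_cast
  rw [show (i : ℝ) + k + 1 - i - l = k + 1 - l by ring]
  ring

theorem tanNumerator_two_mul (n : ℕ) (x : ℝ) :
    tanNumerator (2 * n) x = eulerianSucc (2 * n) n + 2 * ∑ i ∈ range n,
      (-1) ^ (i + 1) * eulerianSucc (2 * n) (n - (i + 1)) * Real.cos (2 * ((i : ℝ) + 1) * x) := by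
  have hterm (k : ℕ) : Real.cos ((2 * k - ((2 * n : ℕ) : ℝ)) * x + ((2 * n : ℕ) : ℝ) * (Real.pi / 2))
      = (-1) ^ n * Real.cos (2 * ((k : ℝ) - n) * x) := by
    rw [← Real.cos_add_nat_mul_pi]
    congr 1
    push_cast
    ring
  have hsq : (-1 : ℝ) ^ n * (-1) ^ n = 1 := by rw [← mul_pow]; simp
  simp only [tanNumerator, hterm]
  rw [sum_range_two_mul_add_one_of_symm]
  · congr 1
    · simp only [sub_self, mul_zero, zero_mul, Real.cos_zero]
      linear_combination eulerianSucc (2 * n) n * hsq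
    · congr 1
      refine sum_congr rfl fun i hi => ?_
      obtain ⟨d, rfl⟩ : ∃ d, n = d + (i + 1) := ⟨n - (i + 1), by have := mem_range.1 hi; omega⟩
      rw [Nat.add_sub_cancel, ← Real.cos_neg (2 * ((i : ℝ) + 1) * x)]
      have hd : (-1 : ℝ) ^ d * (-1) ^ d = 1 := by rw [← mul_pow]; simp
      push_cast
      rw [show 2 * ((d : ℝ) - (d + (i + 1))) * x = -(2 * (i + 1) * x) by ring]
      rw [pow_add]
      linear_combination ((-1) ^ (i + 1) * eulerianSucc (2 * (d + (i + 1))) d *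
        Real.cos (-(2 * ((i : ℝ) + 1) * x))) * hd
  · intro i j hij
    rw [eulerianSucc_symm _ i j hij, ← Real.cos_neg (2 * ((i : ℝ) - n) * x)]
    have hR : (i : ℝ) + j = 2 * n := by exact_mod_cast hij
    rw [show -(2 * ((i : ℝ) - n) * x) = 2 * ((j : ℝ) - n) * x by linear_combination -2 * x * hR]
    have hs : (-1 : ℝ) ^ i = (-1) ^ j := by
      rw [neg_one_pow_eq_pow_mod_two, neg_one_pow_eq_pow_mod_two (n := j),
        show i % 2 = j % 2 by omega]
    rw [hs]

theorem tan_iteratedDeriv_odd_recursion (n : ℕ) (hn : 1 ≤ n) (x : ℝ) (hx : Real.cos x ≠ 0) :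
    iteratedDeriv (2 * n + 1) Real.tan x =
      (1 / Real.cos x ^ (2 * (n + 1))) *
        (((n : ℝ) + 1) * aeven n 0 - aeven n (n - 1) * Real.cos (2 * (n : ℝ) * x)
          + ∑ i ∈ Finset.Icc 1 (n - 1),
              (((n : ℝ) + 1 + i) * aeven n i - ((n : ℝ) + 1 - i) * aeven n (i - 1))
                * Real.cos (2 * (i : ℝ) * x)) := by
  obtain ⟨p, rfl⟩ : ∃ p, n = p + 1 := ⟨n - 1, by omega⟩
  rw [iteratedDeriv_succ_tan _ x hx, div_eq_mul_one_div, mul_comm,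
    show 2 * (p + 1) + 2 = 2 * (p + 1 + 1) by ring]
  congr 1
  rw [tanNumerator_two_mul, sum_range_succ, mul_add 2 (Finset.sum _ _), Nat.add_sub_cancel, Nat.sub_self,
    ← Finset.Ico_add_one_right_eq_Icc, sum_Ico_eq_sum_range, Nat.add_sub_cancel, mul_sum,
    aeven_eq_eulerianSucc p 0 p (by omega), aeven_eq_eulerianSucc p p 0 (by omega)]
  have hmid : eulerianSucc (2 * (p + 1)) (p + 1)
      = 2 * ((p : ℝ) + 2) * eulerianSucc (2 * p + 1) p := by
    rw [show 2 * (p + 1) = 2 * p + 1 + 1 by ring, eulerianSucc,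
      eulerianSucc_symm (2 * p + 1) (p + 1) p (by ring)]
    push_cast
    ring
  have hlast : eulerianSucc (2 * (p + 1)) 0 = eulerianSucc (2 * p + 1) 0 := rfl
  have hsum : ∑ i ∈ range p, 2 * ((-1 : ℝ) ^ (i + 1) *
        eulerianSucc (2 * (p + 1)) (p + 1 - (i + 1)) * Real.cos (2 * ((i : ℝ) + 1) * x))
      = ∑ i ∈ range p, ((((p + 1 : ℕ) : ℝ) + 1 + ((1 + i : ℕ) : ℝ)) * aeven (p + 1) (1 + i)
          - (((p + 1 : ℕ) : ℝ) + 1 - ((1 + i : ℕ) : ℝ)) * aeven (p + 1) (1 + i - 1))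
            * Real.cos (2 * ((1 + i : ℕ) : ℝ) * x) := by
    refine sum_congr rfl fun i hi => ?_
    obtain ⟨d, rfl⟩ : ∃ d, p = d + (i + 1) := ⟨p - (i + 1), by have := mem_range.1 hi; omega⟩
    rw [aeven_eq_eulerianSucc _ (1 + i) d (by omega),
      aeven_eq_eulerianSucc _ (1 + i - 1) (d + 1) (by omega),
      show d + (i + 1) + 1 - (i + 1) = d + 1 by omega, show 1 + i - 1 = i by omega,
      show 2 * (d + (i + 1) + 1) = 2 * (d + (i + 1)) + 1 + 1 by ring, eulerianSucc]
    push_cast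
    rw [add_comm (1 : ℝ) i]
    ring
  rw [hmid, hlast, hsum]
  push_cast
  ring
end

section
/- For every positive integer n and every real number x with cos x ≠ 0, differentiating the closed-form expansion of the (2n+1)-th derivative of tangent term by term gives tan^{(2n+2)}(x) = (1/cos^{2n+3} x) · [ (2(n+1) · a_{2n+1,0} - (n+2) · a_{2n+1,2}) · sin x + a_{2n+1,2n} · sin((2n+1) x) + Σ_{i=1}^{n-1} ( (n+1-i) · a_{2n+1,2i} - (n+2+i) · a_{2n+1,2(i+1)} ) · sin((2i+1) x) ], where a_{2n+1,0} = 2(n+1) · Σ_{ℓ=0}^{n-1} (-1)^ℓ · C(2n+1, ℓ) · (n-ℓ)^{2n} and a_{2n+1,2i} = 2 · Σ_{ℓ=0}^{n-i} (-1)^{i+ℓ} · C(2n+2, ℓ) · (n-i-ℓ+1)^{2n+1} for 1 ≤ i ≤ n. -/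
open Finset

/-- The coefficients `a_{2n+1,2i}` in the expansion of the `(2n+1)`-th derivative of
the tangent function:
`a_{2n+1,0} = 2(n+1) · Σ_{ℓ=0}^{n-1} (-1)^ℓ C(2n+1,ℓ) (n-ℓ)^{2n}` and
`a_{2n+1,2i} = 2 · Σ_{ℓ=0}^{n-i} (-1)^{i+ℓ} C(2n+2,ℓ) (n-i-ℓ+1)^{2n+1}` for `1 ≤ i ≤ n`. -/
noncomputable def aoddc (n i : ℕ) : ℝ :=
  if i = 0 then
    2 * ((n : ℝ) + 1) * ∑ l ∈ Finset.range n,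
      (-1 : ℝ) ^ l * (Nat.choose (2 * n + 1) l : ℝ) * ((n : ℝ) - l) ^ (2 * n)
  else 2 * ∑ l ∈ Finset.range (n - i + 1),
    (-1 : ℝ) ^ (i + l) * (Nat.choose (2 * n + 2) l : ℝ) * ((n : ℝ) - i - l + 1) ^ (2 * n + 1)

/-- The Eulerian numbers, indexed so that `eulerian m k` is the coefficient of `z ^ k` in the
numerator of `∑ j, j ^ m * z ^ j`, with denominator `(1 - z) ^ (m + 1)`. -/
noncomputable def eulerian : ℕ → ℕ → ℝ
  | 0, 0 => 1
  | 0, _ + 1 => 0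
  | _ + 1, 0 => 0
  | m + 1, k + 1 => (k + 1) * eulerian m (k + 1) + ((m : ℝ) + 1 - k) * eulerian m k

theorem eulerian_succ_zero (m : ℕ) : eulerian (m + 1) 0 = 0 := by
  simp [eulerian]

theorem eulerian_succ_succ (m k : ℕ) :
    eulerian (m + 1) (k + 1) =
      (k + 1) * eulerian m (k + 1) + ((m : ℝ) + 1 - k) * eulerian m k := by
  simp [eulerian]

theorem eulerian_eq_zero_of_lt {m k : ℕ} (h : m < k) : eulerian m k = 0 := by
  induction m generalizing k with
  | zero => cases k with
    | zero => omega
    | succ k => simp [eulerian]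
  | succ m ih => cases k with
    | zero => omega
    | succ k => rw [eulerian_succ_succ, ih (by omega), ih (by omega)]; simp

theorem eulerian_symm {m j k : ℕ} (h : j + k = m + 2) :
    eulerian (m + 1) j = eulerian (m + 1) k := by
  induction m generalizing j k with
  | zero =>
    obtain ⟨rfl, rfl⟩ | ⟨rfl, rfl⟩ | ⟨rfl, rfl⟩ :
      (j = 0 ∧ k = 2) ∨ (j = 1 ∧ k = 1) ∨ (j = 2 ∧ k = 0) := by omega
    all_goals simp [eulerian]
  | succ m ih =>
    rcases j with _ | j
    · rw [eulerian_succ_zero, eulerian_eq_zero_of_lt (by omega)]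
    rcases k with _ | k
    · rw [eulerian_succ_zero, eulerian_eq_zero_of_lt (by omega)]
    rw [eulerian_succ_succ _ j, eulerian_succ_succ _ k, ih (j := j + 1) (k := k) (by omega),
      ih (j := j) (k := k + 1) (by omega)]
    have h' : (j : ℝ) + k = m + 1 := by exact_mod_cast (by omega : j + k = m + 1)
    push_cast
    rw [show (j : ℝ) = m + 1 - k by linarith]
    ring

theorem eulerian_eq_sum (m k : ℕ) :
    eulerian m k = ∑ l ∈ range (k + 1),
      (-1 : ℝ) ^ l * (Nat.choose (m + 1) l : ℝ) * ((k : ℝ) - l) ^ m := by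
  induction m generalizing k with
  | zero =>
    rcases k with _ | k
    · simp [eulerian]
    · rw [sum_range_succ', sum_range_succ',
        sum_eq_zero fun l _ => by rw [Nat.choose_eq_zero_of_lt (by omega)]; simp]
      simp [eulerian]
  | succ m ih =>
    rcases k with _ | k
    · simp [eulerian]
    rw [eulerian_succ_succ, ih, ih, sum_range_succ' _ (k + 1), sum_range_succ' _ (k + 1),
      mul_add, mul_sum, mul_sum, add_right_comm, ← sum_add_distrib]
    congr 1
    · refine sum_congr rfl fun l _ => ?_
      have h : ((m : ℝ) + 1 - l) * (m + 1).choose l = (l + 1) * (m + 1).choose (l + 1) := by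
        have h := Nat.add_one_mul_choose_eq (m + 1) l
        rw [Nat.choose_succ_succ] at h
        have h' : ((m : ℝ) + 2) * (m + 1).choose l =
            ((m + 1).choose l + (m + 1).choose (l + 1)) * (l + 1) := by
          exact_mod_cast h
        linarith
      rw [Nat.choose_succ_succ (m + 1) l]
      push_cast
      rw [show (k : ℝ) + 1 - (l + 1) = k - l by ring]
      linear_combination (-1 : ℝ) ^ l * (k - l : ℝ) ^ m * h
    · simp; ring

theorem iteratedDeriv_tan_eq_sum_eulerian (m : ℕ) {x : ℝ} (hx : Real.cos x ≠ 0) :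
    iteratedDeriv m Real.tan x = (-1) ^ (m + 1) / Real.cos x ^ (m + 1) *
      ∑ k ∈ range (m + 1),
        eulerian m k * Real.cos (((m : ℝ) + 1 - 2 * k) * (x + Real.pi / 2)) := by
  induction m generalizing x with
  | zero =>
    simp [eulerian, Real.cos_add_pi_div_two, Real.tan_eq_sin_div_cos]
    ring
  | succ m ih =>
    rw [iteratedDeriv_succ]
    have hev : iteratedDeriv m Real.tan =ᶠ[nhds x] fun y =>
        (-1) ^ (m + 1) / Real.cos y ^ (m + 1) * ∑ k ∈ range (m + 1),
          eulerian m k * Real.cos (((m : ℝ) + 1 - 2 * k) * (y + Real.pi / 2)) := by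
      filter_upwards [Real.continuous_cos.continuousAt.eventually_ne hx] with y hy
      exact ih hy
    rw [hev.deriv_eq]
    have hsum : HasDerivAt (fun y => ∑ k ∈ range (m + 1),
          eulerian m k * Real.cos (((m : ℝ) + 1 - 2 * k) * (y + Real.pi / 2)))
        (∑ k ∈ range (m + 1), eulerian m k *
          (-Real.sin (((m : ℝ) + 1 - 2 * k) * (x + Real.pi / 2)) * ((m : ℝ) + 1 - 2 * k))) x := by
      refine HasDerivAt.fun_sum fun k _ => ?_
      have := (((hasDerivAt_id x).add_const (Real.pi / 2)).const_mul
        ((m : ℝ) + 1 - 2 * k)).cos.const_mul (eulerian m k)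
      simpa using this
    have hpow : HasDerivAt (fun y => (-1) ^ (m + 1) / Real.cos y ^ (m + 1))
        ((-1) ^ (m + 1) * ((m + 1) * Real.sin x) / Real.cos x ^ (m + 2)) x := by
      have := (hasDerivAt_const x ((-1 : ℝ) ^ (m + 1))).fun_div
        ((Real.hasDerivAt_cos x).fun_pow (m + 1)) (pow_ne_zero _ hx)
      refine this.congr_deriv ?_
      rw [Nat.add_sub_cancel]
      push_cast
      field_simp
      ring
    rw [(hpow.fun_mul hsum).deriv]
    have hrec : ∑ k ∈ range (m + 1 + 1), eulerian (m + 1) k *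
          Real.cos ((((m + 1 : ℕ) : ℝ) + 1 - 2 * k) * (x + Real.pi / 2)) =
        ∑ k ∈ range (m + 1), eulerian m k *
          (k * Real.cos (((m : ℝ) + 2 - 2 * k) * (x + Real.pi / 2)) +
            ((m : ℝ) + 1 - k) * Real.cos (((m : ℝ) - 2 * k) * (x + Real.pi / 2))) := by
      have hshift : ∑ k ∈ range (m + 1), ((k : ℝ) + 1) * eulerian m (k + 1) *
            Real.cos (((m : ℝ) - 2 * k) * (x + Real.pi / 2)) =
          ∑ k ∈ range (m + 1), (k : ℝ) * eulerian m k *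
            Real.cos (((m : ℝ) + 2 - 2 * k) * (x + Real.pi / 2)) := by
        rw [sum_range_succ, eulerian_eq_zero_of_lt (Nat.lt_succ_self m), sum_range_succ']
        simp only [mul_zero, zero_mul, add_zero, Nat.cast_zero]
        refine sum_congr rfl fun k _ => ?_
        push_cast
        ring_nf
      rw [sum_range_succ', eulerian_succ_zero, zero_mul, add_zero]
      have hsplit : ∑ k ∈ range (m + 1), eulerian m k *
            (k * Real.cos (((m : ℝ) + 2 - 2 * k) * (x + Real.pi / 2)) +
              ((m : ℝ) + 1 - k) * Real.cos (((m : ℝ) - 2 * k) * (x + Real.pi / 2))) =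
          ∑ k ∈ range (m + 1), (k : ℝ) * eulerian m k *
              Real.cos (((m : ℝ) + 2 - 2 * k) * (x + Real.pi / 2)) +
            ∑ k ∈ range (m + 1), ((m : ℝ) + 1 - k) * eulerian m k *
              Real.cos (((m : ℝ) - 2 * k) * (x + Real.pi / 2)) := by
        rw [← sum_add_distrib]
        exact sum_congr rfl fun k _ => by ring
      rw [hsplit, ← hshift, ← sum_add_distrib]
      refine sum_congr rfl fun k _ => ?_
      rw [eulerian_succ_succ]
      push_cast
      rw [show (m : ℝ) + 1 + 1 - 2 * (k + 1) = m - 2 * k by ring]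
      ring
    rw [hrec, mul_sum, mul_sum, mul_sum, ← sum_add_distrib]
    refine sum_congr rfl fun k _ => ?_
    have hs : Real.sin x = -Real.cos (x + Real.pi / 2) := by rw [Real.cos_add_pi_div_two]; ring
    have hc : Real.cos x = Real.sin (x + Real.pi / 2) := by rw [Real.sin_add_pi_div_two]
    have hplus : Real.cos (((m : ℝ) + 2 - 2 * k) * (x + Real.pi / 2)) =
        Real.cos (((m : ℝ) + 1 - 2 * k) * (x + Real.pi / 2)) * -Real.sin x -
          Real.sin (((m : ℝ) + 1 - 2 * k) * (x + Real.pi / 2)) * Real.cos x := by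
      rw [hs, hc, neg_neg, ← Real.cos_add]
      ring_nf
    have hminus : Real.cos (((m : ℝ) - 2 * k) * (x + Real.pi / 2)) =
        Real.cos (((m : ℝ) + 1 - 2 * k) * (x + Real.pi / 2)) * -Real.sin x +
          Real.sin (((m : ℝ) + 1 - 2 * k) * (x + Real.pi / 2)) * Real.cos x := by
      rw [hs, hc, neg_neg, ← Real.cos_sub]
      ring_nf
    rw [hplus, hminus]
    field_simp
    ring

theorem aoddc_zero {n : ℕ} (hn : n ≠ 0) : aoddc n 0 = eulerian (2 * n + 1) (n + 1) := by
  obtain ⟨n, rfl⟩ := Nat.exists_eq_succ_of_ne_zero hn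
  simp only [Nat.succ_eq_add_one]
  have hsymm : eulerian (2 * (n + 1)) (n + 1 + 1) = eulerian (2 * (n + 1)) (n + 1) :=
    eulerian_symm (m := 2 * n + 1) (by omega)
  rw [eulerian_succ_succ, hsymm, eulerian_eq_sum, sum_range_succ]
  simp [aoddc]
  ring

theorem aoddc_of_pos {n i : ℕ} (hi : i ≠ 0) (hin : i ≤ n) :
    aoddc n i = 2 * (-1) ^ i * eulerian (2 * n + 1) (n + 1 - i) := by
  obtain ⟨j, rfl⟩ := Nat.exists_eq_add_of_le hin
  rw [eulerian_eq_sum, show i + j + 1 - i = j + 1 by omega, sum_range_succ, aoddc, if_neg hi,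
    show i + j - i + 1 = j + 1 by omega, sub_self, zero_pow (by omega), mul_zero,
    add_zero, mul_sum, mul_sum]
  refine sum_congr rfl fun l _ => ?_
  push_cast
  ring

theorem sum_eulerian_mul_cos_even (n : ℕ) (x : ℝ) :
    ∑ k ∈ range (2 * n + 3), eulerian (2 * n + 2) k *
        Real.cos ((2 * (n : ℝ) + 3 - 2 * k) * (x + Real.pi / 2)) =
      -∑ i ∈ range (n + 1), 2 * (-1) ^ i * eulerian (2 * n + 2) (n + 1 - i) *
        Real.sin ((2 * (i : ℝ) + 1) * x) := by
  have hcos (i : ℕ) : Real.cos ((2 * (i : ℝ) + 1) * (x + Real.pi / 2)) =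
      -((-1) ^ i * Real.sin ((2 * (i : ℝ) + 1) * x)) := by
    rw [show (2 * (i : ℝ) + 1) * (x + Real.pi / 2) =
      ((2 * (i : ℝ) + 1) * x + Real.pi / 2) + i * Real.pi by ring,
      Real.cos_add_nat_mul_pi, Real.cos_add_pi_div_two]
    ring
  rw [sum_range_succ', eulerian_succ_zero, zero_mul, add_zero,
    show 2 * n + 2 = (n + 1) + (n + 1) by ring, sum_range_add, ← sum_range_reflect,
    ← sum_add_distrib, ← sum_neg_distrib]
  refine sum_congr rfl fun i hi => ?_
  have hi : i ≤ n := by simpa [Nat.lt_succ_iff] using hi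
  rw [show n + 1 - 1 - i + 1 = n + 1 - i by omega,
    show n + 1 + (n + 1) = 2 * n + 1 + 1 by ring,
    eulerian_symm (m := 2 * n + 1) (j := n + 1 + i + 1) (k := n + 1 - i) (by omega)]
  have h₁ : (2 * (n : ℝ) + 3 - 2 * ((n + 1 - i : ℕ) : ℝ)) = 2 * i + 1 := by
    rw [Nat.cast_sub (by omega)]; push_cast; ring
  have h₂ : (2 * (n : ℝ) + 3 - 2 * ((n + 1 + i + 1 : ℕ) : ℝ)) = -(2 * i + 1) := by
    push_cast; ring
  rw [h₁, h₂, neg_mul, Real.cos_neg, hcos]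
  ring

theorem tan_iteratedDeriv_even_recursion (n : ℕ) (hn : 1 ≤ n) (x : ℝ) (hx : Real.cos x ≠ 0) :
    iteratedDeriv (2 * n + 2) Real.tan x =
      (1 / Real.cos x ^ (2 * n + 3)) *
        ((2 * ((n : ℝ) + 1) * aoddc n 0 - ((n : ℝ) + 2) * aoddc n 1) * Real.sin x
          + aoddc n n * Real.sin ((2 * (n : ℝ) + 1) * x)
          + ∑ i ∈ Finset.Icc 1 (n - 1),
              (((n : ℝ) + 1 - i) * aoddc n i - ((n : ℝ) + 2 + i) * aoddc n (i + 1))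
                * Real.sin ((2 * (i : ℝ) + 1) * x)) := by
  obtain ⟨p, rfl⟩ : ∃ p, n = p + 1 := ⟨n - 1, by omega⟩
  have hrec (i : ℕ) (hi : i ≤ p + 1) :
      eulerian (2 * (p + 1) + 2) (p + 1 + 1 - i) =
        (((p + 1 : ℕ) : ℝ) + 1 - i) * eulerian (2 * (p + 1) + 1) (p + 1 + 1 - i) +
          (((p + 1 : ℕ) : ℝ) + 2 + i) * eulerian (2 * (p + 1) + 1) (p + 1 - i) := by
    obtain ⟨j, hj⟩ := Nat.exists_eq_add_of_le hi
    have hj' : (p : ℝ) + 1 = i + j := by exact_mod_cast hj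
    rw [show p + 1 + 1 - i = j + 1 by omega, show p + 1 - i = j by omega, eulerian_succ_succ]
    push_cast
    linear_combination (eulerian (2 * (p + 1) + 1) j - eulerian (2 * (p + 1) + 1) (j + 1)) * hj'
  rw [iteratedDeriv_tan_eq_sum_eulerian _ hx]
  have hsum := sum_eulerian_mul_cos_even (p + 1) x
  have hcast : (((2 * (p + 1) + 2 : ℕ) : ℝ) + 1) = 2 * ((p + 1 : ℕ) : ℝ) + 3 := by
    push_cast; ring
  rw [hcast, hsum, Odd.neg_one_pow ⟨p + 2, by ring⟩, neg_div, neg_mul_neg]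
  congr 1
  rw [sum_range_succ, sum_range_succ', show p + 1 - 1 = p by omega,
    ← Ico_succ_right_eq_Icc, sum_Ico_eq_sum_range, aoddc_zero (Nat.succ_ne_zero p),
    aoddc_of_pos one_ne_zero (by omega), aoddc_of_pos (Nat.succ_ne_zero p) le_rfl]
  have hmid : ∑ i ∈ range p, 2 * (-1) ^ (i + 1) *
        eulerian (2 * (p + 1) + 2) (p + 1 + 1 - (i + 1)) *
        Real.sin ((2 * ((i + 1 : ℕ) : ℝ) + 1) * x) =
      ∑ i ∈ range p,
        ((((p + 1 : ℕ) : ℝ) + 1 - ((1 + i : ℕ) : ℝ)) * aoddc (p + 1) (1 + i) -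
          (((p + 1 : ℕ) : ℝ) + 2 + ((1 + i : ℕ) : ℝ)) * aoddc (p + 1) (1 + i + 1)) *
          Real.sin ((2 * ((1 + i : ℕ) : ℝ) + 1) * x) := by
    refine sum_congr rfl fun i hi => ?_
    have hi : i < p := by simpa using hi
    rw [aoddc_of_pos (by omega) (by omega), aoddc_of_pos (by omega) (by omega),
      hrec (i + 1) (by omega), add_comm 1 i,
      show p + 1 + 1 - (i + 1 + 1) = p + 1 - (i + 1) by omega]
    ring
  have hzero := hrec 0 (by omega)
  have hlast := hrec (p + 1) le_rfl
  simp only [Nat.sub_zero, Nat.sub_self, eulerian_succ_zero] at hzero hlast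
  rw [hmid, Nat.sub_zero, hzero, hlast]
  simp
  ring
end
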